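/- For every ε>0, integer k≥1, and R>1, there exists M(ε)≥1 such that for every m≥M(ε) there exists δ₀=δ₀(ε,k,R,m)>0 such that for all 0<δ<δ₀ the following holds. Let p∈P_k, x∈I, let ν be a compactly supported Borel probability measure on P_k and θ one on I such that ‖p‖_2 ≤ R, ‖q−p‖_2 ≤ δ for all q∈supp(ν), and |y−x| ≤ δ for all y∈supp(θ). Then | (1/m)H(ν.θ, D_{m−log δ}) − (1/m)H( (ν.x) * (S_{p'(x)}θ), D_{m−log δ}) | < ε, where S_{p'(x)}θ is the pushforward of θ under scaling by p'(x) and * is convolution. -/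

import Mathlib

open MeasureTheory Filter Set Metric Topology

noncomputable section

/-- The unit interval `I = [0,1]`. -/
def unitI : Set ℝ := Set.Icc 0 1

/-- The level-`n` dyadic interval `[m/2^n, (m+1)/2^n)`. -/
def dyadIco (n : ℕ) (m : ℤ) : Set ℝ :=
  Set.Ico ((m : ℝ) / 2 ^ n) (((m : ℝ) + 1) / 2 ^ n)

/-- Entropy of a measure on `ℝ` with respect to the level-`n` dyadic partition
(logarithms in base 2). -/
def ent1 (n : ℕ) (θ : Measure ℝ) : ℝ :=
  -∑' m : ℤ, (θ (dyadIco n m)).toReal * Real.logb 2 (θ (dyadIco n m)).toReal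

/-- The level-`n` dyadic cell containing `x`. -/
def dcell (n : ℕ) (x : ℝ) : Set ℝ := dyadIco n ⌊x * 2 ^ n⌋

/-- The level-`n` component `θ_{x,n}`: `θ` conditioned on the dyadic cell of `x`. -/
def dcomp (θ : Measure ℝ) (x : ℝ) (n : ℕ) : Measure ℝ :=
  (θ (dcell n x))⁻¹ • θ.restrict (dcell n x)

/-- The space `P_k` of polynomials of degree at most `k`, identified with `ℝ^{k+1}`
via coefficients; `polyEval k a` is the corresponding polynomial function. -/
def polyEval (k : ℕ) (a : EuclideanSpace ℝ (Fin (k + 1))) (x : ℝ) : ℝ :=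
  ∑ j : Fin (k + 1), a j * x ^ (j : ℕ)

/-- The level-`n` dyadic cell of `ℝ^d` indexed by `m : Fin d → ℤ`. -/
def vcell (d n : ℕ) (m : Fin d → ℤ) : Set (EuclideanSpace ℝ (Fin d)) :=
  {x | ∀ j, x j ∈ Set.Ico ((m j : ℝ) / 2 ^ n) (((m j : ℝ) + 1) / 2 ^ n)}

/-- Entropy of a measure on `ℝ^d ≃ P_{d-1}` with respect to the level-`n` dyadic
partition (logarithms in base 2). -/
def entV (d n : ℕ) (θ : Measure (EuclideanSpace ℝ (Fin d))) : ℝ :=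
  -∑' m : Fin d → ℤ,
    (θ (vcell d n m)).toReal * Real.logb 2 (θ (vcell d n m)).toReal

/-- The level-`n` component `ν_{q,n}` of a measure on `ℝ^d`. -/
def vcomp {d : ℕ} (ν : Measure (EuclideanSpace ℝ (Fin d)))
    (q : EuclideanSpace ℝ (Fin d)) (n : ℕ) : Measure (EuclideanSpace ℝ (Fin d)) :=
  (ν (vcell d n fun j => ⌊q j * 2 ^ n⌋))⁻¹ • ν.restrict (vcell d n fun j => ⌊q j * 2 ^ n⌋)

/-- The topological support of a measure. -/
def msupp {X : Type*} [TopologicalSpace X] [MeasurableSpace X] (θ : Measure X) : Set X :=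
  {x | ∀ U : Set X, IsOpen U → x ∈ U → θ U ≠ 0}

/-- The measure `ν.θ`: the pushforward of `ν × θ` under `(q, x) ↦ q(x)`. -/
def pact (k : ℕ) (ν : Measure (EuclideanSpace ℝ (Fin (k + 1)))) (θ : Measure ℝ) :
    Measure ℝ :=
  (ν.prod θ).map fun q => polyEval k q.1 q.2

/-- Convolution of two measures on `ℝ`. -/
def mconv (ξ θ : Measure ℝ) : Measure ℝ :=
  (ξ.prod θ).map fun q => q.1 + q.2

/-- If a coupling `w` of two finite distributions `a`, `b` is supported on pairs whose difference
lies in a set `T`, then the entropy of `a` exceeds that of `b` by at most `log #T`. -/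
theorem sum_negMulLog_le_add_log_card (K T : Finset ℤ) (w : ℤ → ℤ → ℝ) (a b : ℤ → ℝ)
    (hw : ∀ i j, 0 ≤ w i j) (hT : ∀ i j, w i j ≠ 0 → i - j ∈ T)
    (ha : ∀ i ∈ K, a i = ∑ j ∈ K, w i j) (hb : ∀ j ∈ K, b j = ∑ i ∈ K, w i j)
    (hsum : ∑ j ∈ K, b j = 1) :
    ∑ i ∈ K, Real.negMulLog (a i) ≤ ∑ j ∈ K, Real.negMulLog (b j) + Real.log T.card := by
  classical
  have hb0 : ∀ j ∈ K, 0 ≤ b j := fun j hj => by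
    rw [hb j hj]; exact Finset.sum_nonneg fun i _ => hw i j
  have hT0 : 0 < (T.card : ℝ) := by
    rcases Nat.eq_zero_or_pos T.card with h | h
    · exfalso
      rw [Finset.card_eq_zero] at h
      have hz : ∀ i j, w i j = 0 := fun i j => by
        by_contra hne
        simpa [h] using hT i j hne
      rw [Finset.sum_congr rfl hb] at hsum
      simp [hz] at hsum
    · exact_mod_cast h
  set s : ℤ → ℝ := fun i => ∑ j ∈ K, if i - j ∈ T then b j / T.card else 0 with hs
  have hs0 : ∀ i, 0 ≤ s i := fun i => Finset.sum_nonneg fun j hj => by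
    split_ifs
    · exact div_nonneg (hb0 j hj) hT0.le
    · exact le_rfl
  have hs_sum : ∑ i ∈ K, s i ≤ 1 := by
    rw [hs, Finset.sum_comm, ← hsum]
    refine Finset.sum_le_sum fun j hj => ?_
    rw [← Finset.sum_filter, Finset.sum_const, nsmul_eq_mul]
    have hc : (K.filter fun i => i - j ∈ T).card ≤ T.card :=
      Finset.card_le_card_of_injOn (fun i => i - j)
        (fun i hi => (Finset.mem_filter.1 hi).2) (fun i _ i' _ h => by simpa using h)
    calc ((K.filter fun i => i - j ∈ T).card : ℝ) * (b j / T.card)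
        ≤ T.card * (b j / T.card) :=
          mul_le_mul_of_nonneg_right (by exact_mod_cast hc) (div_nonneg (hb0 j hj) hT0.le)
      _ = b j := by field_simp
  have hw_le : ∀ i ∈ K, ∀ j ∈ K, w i j ≤ b j := fun i hi j hj => by
    rw [hb j hj]
    exact Finset.single_le_sum (f := fun i => w i j) (fun i _ => hw i j) hi
  have hs_ge : ∀ i ∈ K, ∀ j ∈ K, w i j ≠ 0 → b j / T.card ≤ s i := fun i hi j hj hne => by
    have := Finset.single_le_sum (f := fun j => if i - j ∈ T then b j / (T.card : ℝ) else 0)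
      (fun j hj => by
        split_ifs
        · exact div_nonneg (hb0 j hj) hT0.le
        · exact le_rfl) hj
    simpa [hT i j hne, hs] using this
  have key : ∀ i ∈ K, Real.negMulLog (a i) ≤
      ∑ j ∈ K, w i j * (Real.log T.card - Real.log (b j)) + s i - a i := fun i hi => by
    have hai : 0 ≤ a i := by rw [ha i hi]; exact Finset.sum_nonneg fun j _ => hw i j
    rcases hai.eq_or_lt with h0 | hpos
    · have hz : ∀ j ∈ K, w i j = 0 := by
        rw [ha i hi] at h0
        exact (Finset.sum_eq_zero_iff_of_nonneg fun j _ => hw i j).1 h0.symm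
      rw [← h0, Finset.sum_eq_zero fun j hj => by rw [hz j hj, zero_mul]]
      simpa using hs0 i
    · obtain ⟨j, hj, hne⟩ : ∃ j ∈ K, w i j ≠ 0 := by
        by_contra! h
        rw [ha i hi, Finset.sum_eq_zero h] at hpos
        exact lt_irrefl _ hpos
      have hwpos : 0 < w i j := lt_of_le_of_ne (hw i j) hne.symm
      have hsi : 0 < s i :=
        (div_pos (hwpos.trans_le (hw_le i hi j hj)) hT0).trans_le (hs_ge i hi j hj hne)
      have h1 : Real.log (s i / a i) ≤ s i / a i - 1 :=
        Real.log_le_sub_one_of_pos (div_pos hsi hpos)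
      rw [Real.log_div hsi.ne' hpos.ne'] at h1
      have h2 := mul_le_mul_of_nonneg_left h1 hai
      have h3 : a i * (s i / a i - 1) = s i - a i := by field_simp
      have h4 : a i * (-Real.log (s i)) ≤
          ∑ j ∈ K, w i j * (Real.log T.card - Real.log (b j)) := by
        rw [ha i hi, Finset.sum_mul]
        refine Finset.sum_le_sum fun l hl => ?_
        by_cases hl0 : w i l = 0
        · simp [hl0]
        · have hbl : 0 < b l := (lt_of_le_of_ne (hw i l) (Ne.symm hl0)).trans_le (hw_le i hi l hl)
          have := Real.log_le_log (div_pos hbl hT0) (hs_ge i hi l hl hl0)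
          rw [Real.log_div hbl.ne' hT0.ne'] at this
          exact mul_le_mul_of_nonneg_left (by linarith) (hw i l)
      rw [Real.negMulLog]
      nlinarith
  have hab : ∑ i ∈ K, a i = 1 := by
    rw [← hsum, Finset.sum_congr rfl ha, Finset.sum_comm, Finset.sum_congr rfl hb]
  have hmain : ∑ i ∈ K, ∑ j ∈ K, w i j * (Real.log T.card - Real.log (b j)) =
      ∑ j ∈ K, Real.negMulLog (b j) + Real.log T.card := by
    rw [Finset.sum_comm]
    have : ∀ j ∈ K, ∑ i ∈ K, w i j * (Real.log T.card - Real.log (b j)) =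
        Real.negMulLog (b j) + b j * Real.log T.card := fun j hj => by
      rw [← Finset.sum_mul, ← hb j hj, Real.negMulLog]; ring
    rw [Finset.sum_congr rfl this, Finset.sum_add_distrib, ← Finset.sum_mul, hsum, one_mul]
  calc ∑ i ∈ K, Real.negMulLog (a i)
      ≤ ∑ i ∈ K, (∑ j ∈ K, w i j * (Real.log T.card - Real.log (b j)) + s i - a i) :=
        Finset.sum_le_sum key
    _ = ∑ j ∈ K, Real.negMulLog (b j) + Real.log T.card + ∑ i ∈ K, s i - 1 := by
        rw [Finset.sum_sub_distrib, Finset.sum_add_distrib, hmain, hab]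
    _ ≤ _ := by linarith

theorem mem_dyadIco_iff (n : ℕ) (m : ℤ) (x : ℝ) : x ∈ dyadIco n m ↔ ⌊x * 2 ^ n⌋ = m := by
  have h : (0 : ℝ) < 2 ^ n := by positivity
  rw [Int.floor_eq_iff, dyadIco, Set.mem_Ico, div_le_iff₀ h, lt_div_iff₀ h]

theorem sum_measureReal_inter_preimage {Ω : Type*} [MeasurableSpace Ω] (μ : Measure Ω)
    [IsFiniteMeasure μ] {B : Ω → ℤ} (hB : Measurable B) (K : Finset ℤ)
    (hK : ∀ᵐ ω ∂μ, B ω ∈ K) (s : Set Ω) :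
    ∑ j ∈ K, μ.real (s ∩ B ⁻¹' {j}) = μ.real s := by
  have h := sum_measureReal_preimage_singleton (μ := μ.restrict s) (f := B) K
    (fun j _ => hB (measurableSet_singleton j))
  simp_rw [measureReal_restrict_apply (hB (measurableSet_singleton _))] at h
  rw [measureReal_restrict_apply (hB K.measurableSet)] at h
  simp_rw [Set.inter_comm s]
  rw [h]
  refine measureReal_congr ?_
  filter_upwards [hK] with ω hω
  exact propext ⟨fun h => h.2, fun h => ⟨hω, h⟩⟩

theorem ent1_map_eq_sum {Ω : Type*} [MeasurableSpace Ω] (μ : Measure Ω)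
    {f : Ω → ℝ} (hf : Measurable f) (n : ℕ) (K : Finset ℤ)
    (hK : ∀ᵐ ω ∂μ, ⌊f ω * 2 ^ n⌋ ∈ K) :
    ent1 n (μ.map f) =
      (∑ i ∈ K, Real.negMulLog (μ.real ((fun ω => ⌊f ω * 2 ^ n⌋) ⁻¹' {i}))) / Real.log 2 := by
  have hcell : ∀ i, ((μ.map f) (dyadIco n i)).toReal =
      μ.real ((fun ω => ⌊f ω * 2 ^ n⌋) ⁻¹' {i}) := fun i => by
    rw [Measure.map_apply hf (show MeasurableSet (dyadIco n i) from measurableSet_Ico),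
      Measure.real]
    congr 2
    ext ω
    exact mem_dyadIco_iff n i (f ω)
  unfold ent1
  simp_rw [hcell]
  rw [tsum_eq_sum (s := K), Finset.sum_div, ← Finset.sum_neg_distrib]
  · exact Finset.sum_congr rfl fun i _ => by rw [Real.negMulLog, Real.logb]; ring
  · intro i hi
    have : μ.real ((fun ω => ⌊f ω * 2 ^ n⌋) ⁻¹' {i}) = 0 := by
      rw [Measure.real, measure_mono_null (t := {ω | ¬ ⌊f ω * 2 ^ n⌋ ∈ K}) _ hK]
      · rfl
      · rintro ω rfl
        exact hi
    rw [this, zero_mul]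

/-- If two bounded functions differ, up to a fixed translation, by at most one dyadic scale, then
the level-`n` entropies of their distributions differ by at most two bits. -/
theorem ent1_map_le_add_two {Ω : Type*} [MeasurableSpace Ω] (μ : Measure Ω)
    [IsProbabilityMeasure μ] {f g : Ω → ℝ} (hf : Measurable f) (hg : Measurable g) (n : ℕ)
    (c B : ℝ) (hfB : ∀ᵐ ω ∂μ, |f ω| ≤ B) (hgB : ∀ᵐ ω ∂μ, |g ω| ≤ B)
    (hfg : ∀ᵐ ω ∂μ, |f ω - g ω - c| * 2 ^ n ≤ 1) :
    ent1 n (μ.map f) ≤ ent1 n (μ.map g) + 2 := by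
  have h2 : (0 : ℝ) < 2 ^ n := by positivity
  set K : Finset ℤ := Finset.Icc ⌊-B * 2 ^ n⌋ ⌊B * 2 ^ n⌋
  have hmemK : ∀ t : ℝ, |t| ≤ B → ⌊t * 2 ^ n⌋ ∈ K := fun t ht => by
    rw [abs_le] at ht
    exact Finset.mem_Icc.2 ⟨Int.floor_mono (mul_le_mul_of_nonneg_right ht.1 h2.le),
      Int.floor_mono (mul_le_mul_of_nonneg_right ht.2 h2.le)⟩
  have hfK : ∀ᵐ ω ∂μ, ⌊f ω * 2 ^ n⌋ ∈ K := hfB.mono fun ω h => hmemK _ h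
  have hgK : ∀ᵐ ω ∂μ, ⌊g ω * 2 ^ n⌋ ∈ K := hgB.mono fun ω h => hmemK _ h
  set F : Ω → ℤ := fun ω => ⌊f ω * 2 ^ n⌋
  set G : Ω → ℤ := fun ω => ⌊g ω * 2 ^ n⌋
  have hF : Measurable F := (hf.mul_const _).floor
  have hG : Measurable G := (hg.mul_const _).floor
  set T : Finset ℤ := Finset.Icc (⌊c * 2 ^ n⌋ - 1) (⌊c * 2 ^ n⌋ + 2)
  have hTcard : T.card = 4 := by
    rw [Int.card_Icc]; omega
  have hFG : ∀ᵐ ω ∂μ, F ω - G ω ∈ T := by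
    filter_upwards [hfg] with ω h
    rw [← abs_of_pos h2, ← abs_mul, abs_le] at h
    have hf1 := Int.floor_le (f ω * 2 ^ n)
    have hf2 := Int.lt_floor_add_one (f ω * 2 ^ n)
    have hg1 := Int.floor_le (g ω * 2 ^ n)
    have hg2 := Int.lt_floor_add_one (g ω * 2 ^ n)
    have hc1 := Int.floor_le (c * 2 ^ n)
    have hc2 := Int.lt_floor_add_one (c * 2 ^ n)
    have hlo : ⌊c * 2 ^ n⌋ - 2 < F ω - G ω := by
      have : ((⌊c * 2 ^ n⌋ - 2 : ℤ) : ℝ) < ((F ω - G ω : ℤ) : ℝ) := by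
        push_cast
        simp only [F, G]
        linarith
      exact_mod_cast this
    have hhi : F ω - G ω < ⌊c * 2 ^ n⌋ + 3 := by
      have : ((F ω - G ω : ℤ) : ℝ) < ((⌊c * 2 ^ n⌋ + 3 : ℤ) : ℝ) := by
        push_cast
        simp only [F, G]
        linarith
      exact_mod_cast this
    exact Finset.mem_Icc.2 ⟨by omega, by omega⟩
  rw [ent1_map_eq_sum μ hf n K hfK, ent1_map_eq_sum μ hg n K hgK]
  have hlog : 0 < Real.log 2 := Real.log_pos one_lt_two
  have hmain := sum_negMulLog_le_add_log_card K T
    (fun i j => μ.real (F ⁻¹' {i} ∩ G ⁻¹' {j})) (fun i => μ.real (F ⁻¹' {i}))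
    (fun j => μ.real (G ⁻¹' {j})) (fun _ _ => measureReal_nonneg)
    (fun i j hne => by
      by_contra hij
      refine hne ?_
      rw [Measure.real, measure_mono_null (t := {ω | ¬ F ω - G ω ∈ T}) _ hFG]
      · rfl
      · rintro ω ⟨rfl, rfl⟩
        exact hij)
    (fun i _ => (sum_measureReal_inter_preimage μ hG K hgK _).symm)
    (fun j _ => by
      simp_rw [Set.inter_comm _ (G ⁻¹' {j})]
      exact (sum_measureReal_inter_preimage μ hF K hfK _).symm)
    (by simpa using sum_measureReal_inter_preimage μ hG K hgK Set.univ)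
  have h4 : Real.log T.card = 2 * Real.log 2 := by
    rw [hTcard, show ((4 : ℕ) : ℝ) = 2 ^ 2 by norm_num, Real.log_pow]; norm_num
  rw [h4] at hmain
  rw [div_add' _ _ _ hlog.ne']
  exact div_le_div_of_nonneg_right hmain hlog.le

theorem ae_mem_msupp {X : Type*} [TopologicalSpace X] [SecondCountableTopology X]
    [MeasurableSpace X] (θ : Measure X) : ∀ᵐ x ∂θ, x ∈ msupp θ := by
  refine measure_null_of_locally_null _ fun x hx => ?_
  have hx' : ¬ x ∈ msupp θ := hx
  simp only [msupp, Set.mem_ofPred_eq, not_forall, not_not] at hx'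
  obtain ⟨U, hU, hxU, h0⟩ := hx'
  exact ⟨U, mem_nhdsWithin_of_mem_nhds (hU.mem_nhds hxU), h0⟩

theorem abs_pow_sub_pow_sub_le {x y : ℝ} (hx : x ∈ unitI) (hy : y ∈ unitI) (j : ℕ) :
    |y ^ j - x ^ j - j * x ^ (j - 1) * (y - x)| ≤ (j : ℝ) ^ 2 * (y - x) ^ 2 := by
  induction j with
  | zero => simp
  | succ j ih =>
    have hstep : y ^ (j + 1) - x ^ (j + 1) - ((j + 1 : ℕ) : ℝ) * x ^ (j + 1 - 1) * (y - x) =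
        y * (y ^ j - x ^ j - j * x ^ (j - 1) * (y - x)) + j * x ^ (j - 1) * (y - x) ^ 2 := by
      rcases j with _ | j
      · simp
      · push_cast
        ring
    rw [hstep]
    have h1 : |y * (y ^ j - x ^ j - j * x ^ (j - 1) * (y - x))| ≤
        (j : ℝ) ^ 2 * (y - x) ^ 2 := by
      rw [abs_mul, abs_of_nonneg hy.1]
      exact (mul_le_of_le_one_left (abs_nonneg _) hy.2).trans ih
    have h2 : |(j : ℝ) * x ^ (j - 1) * (y - x) ^ 2| ≤ j * (y - x) ^ 2 := by
      have hxp : 0 ≤ x ^ (j - 1) := pow_nonneg hx.1 _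
      rw [abs_of_nonneg (by positivity)]
      refine mul_le_mul_of_nonneg_right ?_ (sq_nonneg _)
      exact mul_le_of_le_one_right (Nat.cast_nonneg j) (pow_le_one₀ hx.1 hx.2)
    refine (abs_add_le _ _).trans ((add_le_add h1 h2).trans ?_)
    push_cast
    have := sq_nonneg (y - x)
    have := Nat.cast_nonneg (α := ℝ) j
    nlinarith

theorem deriv_polyEval (k : ℕ) (p : EuclideanSpace ℝ (Fin (k + 1))) (x : ℝ) :
    deriv (polyEval k p) x = ∑ j : Fin (k + 1), p j * ((j : ℕ) * x ^ ((j : ℕ) - 1)) := by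
  refine HasDerivAt.deriv ?_
  unfold polyEval
  exact HasDerivAt.fun_sum fun j _ => (hasDerivAt_pow (j : ℕ) x).const_mul (p j)

/-- Uniform first-order expansion of polynomials near `p`, with the slope frozen at `p`. -/
theorem abs_polyEval_sub_le {k : ℕ} {R δ : ℝ} (hδ : 0 ≤ δ) (hδ1 : δ ≤ 1)
    {p q : EuclideanSpace ℝ (Fin (k + 1))} (hp : ‖p‖ ≤ R) (hq : ‖q - p‖ ≤ δ)
    {x y : ℝ} (hx : x ∈ unitI) (hy : y ∈ unitI) (hxy : |y - x| ≤ δ) :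
    |polyEval k q y - polyEval k q x - deriv (polyEval k p) x * (y - x)| ≤
      (∑ j : Fin (k + 1), ((R + 1) * ((j : ℕ) : ℝ) ^ 2 + (j : ℕ))) * δ ^ 2 := by
  have heq : polyEval k q y - polyEval k q x - deriv (polyEval k p) x * (y - x) =
      ∑ j : Fin (k + 1), (q j * (y ^ (j : ℕ) - x ^ (j : ℕ) -
        (j : ℕ) * x ^ ((j : ℕ) - 1) * (y - x)) +
        (q j - p j) * ((j : ℕ) * x ^ ((j : ℕ) - 1)) * (y - x)) := by
    rw [deriv_polyEval, polyEval, polyEval, Finset.sum_mul, ← Finset.sum_sub_distrib,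
      ← Finset.sum_sub_distrib]
    exact Finset.sum_congr rfl fun j _ => by ring
  rw [heq, Finset.sum_mul]
  refine (Finset.abs_sum_le_sum_abs _ _).trans (Finset.sum_le_sum fun j _ => ?_)
  have hsq : (y - x) ^ 2 ≤ δ ^ 2 := by
    rw [← sq_abs (y - x)]
    exact pow_le_pow_left₀ (abs_nonneg _) hxy 2
  have hqR : ‖q‖ ≤ R + 1 := by
    have := norm_add_le (q - p) p
    rw [sub_add_cancel] at this
    linarith
  have hqj : |q j| ≤ R + 1 := (PiLp.norm_apply_le q j).trans hqR
  have hdj : |q j - p j| ≤ δ := by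
    have := PiLp.norm_apply_le (q - p) j
    exact this.trans hq
  have hR : 0 ≤ R + 1 := (abs_nonneg _).trans hqj
  have h1 : |q j * (y ^ (j : ℕ) - x ^ (j : ℕ) - (j : ℕ) * x ^ ((j : ℕ) - 1) * (y - x))| ≤
      (R + 1) * (((j : ℕ) : ℝ) ^ 2 * δ ^ 2) := by
    rw [abs_mul]
    refine mul_le_mul hqj ((abs_pow_sub_pow_sub_le hx hy j).trans ?_) (abs_nonneg _) hR
    exact mul_le_mul_of_nonneg_left hsq (sq_nonneg _)
  have h2 : |(q j - p j) * ((j : ℕ) * x ^ ((j : ℕ) - 1)) * (y - x)| ≤ δ * (j : ℕ) * δ := by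
    rw [abs_mul, abs_mul]
    have hxp : 0 ≤ x ^ ((j : ℕ) - 1) := pow_nonneg hx.1 _
    rw [abs_of_nonneg (a := ((j : ℕ) : ℝ) * x ^ ((j : ℕ) - 1)) (by positivity)]
    have h3 : ((j : ℕ) : ℝ) * x ^ ((j : ℕ) - 1) ≤ (j : ℕ) :=
      mul_le_of_le_one_right (Nat.cast_nonneg _) (pow_le_one₀ hx.1 hx.2)
    gcongr
  refine (abs_add_le _ _).trans ((add_le_add h1 h2).trans (le_of_eq ?_))
  ring

theorem continuous_polyEval (k : ℕ) :
    Continuous fun z : EuclideanSpace ℝ (Fin (k + 1)) × ℝ => polyEval k z.1 z.2 := by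
  unfold polyEval
  fun_prop

/-- At the scale `n = ⌊m - log₂ δ⌋`, dyadic cells have length at least `2 ^ (-m) δ`. -/
theorem two_pow_floor_mul_le (m : ℕ) {δ : ℝ} (hδ : 0 < δ) (hδ1 : δ ≤ 1) :
    2 ^ ⌊(m : ℝ) - Real.logb 2 δ⌋₊ * δ ≤ (2 : ℝ) ^ m := by
  have hlog : Real.logb 2 δ ≤ 0 := Real.logb_nonpos one_lt_two hδ.le hδ1
  have hfl := Nat.floor_le (a := (m : ℝ) - Real.logb 2 δ)
    (by have := Nat.cast_nonneg (α := ℝ) m; linarith)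
  have h := Real.rpow_le_rpow_of_exponent_le one_le_two hfl
  rw [Real.rpow_natCast, Real.rpow_sub two_pos, Real.rpow_natCast,
    Real.rpow_logb two_pos (by norm_num) hδ] at h
  exact (le_div_iff₀ hδ).1 h

theorem linearization
    (ε : ℝ) (hε : 0 < ε) (k : ℕ) (hk : 1 ≤ k) (R : ℝ) (hR : 1 < R) :
    ∃ M : ℕ, 1 ≤ M ∧ ∀ m : ℕ, M ≤ m →
      ∃ δ₀ : ℝ, 0 < δ₀ ∧ ∀ δ : ℝ, 0 < δ → δ < δ₀ →
        ∀ p : EuclideanSpace ℝ (Fin (k + 1)), ∀ x ∈ unitI,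
          ∀ ν : Measure (EuclideanSpace ℝ (Fin (k + 1))), IsProbabilityMeasure ν →
            (∃ S : Set (EuclideanSpace ℝ (Fin (k + 1))), IsCompact S ∧ ν Sᶜ = 0) →
            ∀ θ : Measure ℝ, IsProbabilityMeasure θ → θ unitIᶜ = 0 →
              ‖p‖ ≤ R → (∀ q ∈ msupp ν, ‖q - p‖ ≤ δ) →
              (∀ y ∈ msupp θ, |y - x| ≤ δ) →
              |(1 / (m : ℝ)) * ent1 ⌊(m : ℝ) - Real.logb 2 δ⌋₊ (pact k ν θ) -
                  (1 / (m : ℝ)) * ent1 ⌊(m : ℝ) - Real.logb 2 δ⌋₊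
                    (mconv (ν.map fun q => polyEval k q x)
                      (θ.map fun y => deriv (polyEval k p) x * y))| < ε := by
  obtain ⟨M, hM⟩ := exists_nat_gt (2 / ε)
  refine ⟨M + 1, by omega, fun m hm => ?_⟩
  have hmpos : (0 : ℝ) < m := by exact_mod_cast (by omega : 0 < m)
  have hmε : 2 < m * ε := by
    have : (M : ℝ) ≤ m := by exact_mod_cast (by omega : M ≤ m)
    exact (div_lt_iff₀ hε).1 (hM.trans_le this)
  set C : ℝ := ∑ j : Fin (k + 1), ((R + 1) * ((j : ℕ) : ℝ) ^ 2 + (j : ℕ))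
  have hC : 0 ≤ C := Finset.sum_nonneg fun j _ => by positivity
  refine ⟨min 1 (1 / ((C + 1) * 2 ^ m)), by positivity, ?_⟩
  intro δ hδ hδ0 p x hx ν hν hνc θ hθ hθI hp hνδ hθδ
  obtain ⟨S, hS, hνS⟩ := hνc
  have hδ1 : δ ≤ 1 := (hδ0.trans_le (min_le_left _ _)).le
  have hδ2 : (C + 1) * 2 ^ m * δ ≤ 1 := by
    have := (hδ0.trans_le (min_le_right _ _)).le
    rw [le_div_iff₀ (by positivity)] at this
    linarith
  set n := ⌊(m : ℝ) - Real.logb 2 δ⌋₊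
  set d := deriv (polyEval k p) x
  set f : EuclideanSpace ℝ (Fin (k + 1)) × ℝ → ℝ := fun z => polyEval k z.1 z.2
  set g : EuclideanSpace ℝ (Fin (k + 1)) × ℝ → ℝ := fun z => polyEval k z.1 x + d * z.2
  have hfc : Continuous f := continuous_polyEval k
  have hevc : Continuous fun q : EuclideanSpace ℝ (Fin (k + 1)) => polyEval k q x :=
    (continuous_polyEval k).comp (continuous_id.prodMk continuous_const)
  have hgc : Continuous g :=
    (hevc.comp continuous_fst).add (continuous_const.mul continuous_snd)
  have hconv : mconv (ν.map fun q => polyEval k q x) (θ.map fun y => d * y) =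
      (ν.prod θ).map g := by
    have hmul : Measurable fun y : ℝ => d * y := measurable_const_mul d
    rw [mconv, Measure.map_prod_map _ _ hevc.measurable hmul,
      Measure.map_map (g := fun q : ℝ × ℝ => q.1 + q.2) (measurable_fst.add measurable_snd)
        (hevc.measurable.prodMap hmul)]
    rfl
  have hfst : ∀ {P : EuclideanSpace ℝ (Fin (k + 1)) → Prop}, (∀ᵐ q ∂ν, P q) →
      ∀ᵐ z ∂ν.prod θ, P z.1 := fun h => Measure.quasiMeasurePreserving_fst.ae h
  have hsnd : ∀ {P : ℝ → Prop}, (∀ᵐ y ∂θ, P y) →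
      ∀ᵐ z ∂ν.prod θ, P z.2 := fun h => Measure.quasiMeasurePreserving_snd.ae h
  have haeS : ∀ᵐ z ∂ν.prod θ, z.1 ∈ S := hfst (P := (· ∈ S)) hνS
  have haeI : ∀ᵐ z ∂ν.prod θ, z.2 ∈ unitI := hsnd (P := (· ∈ unitI)) hθI
  have hK : IsCompact (S ×ˢ unitI) := hS.prod isCompact_Icc
  obtain ⟨B₁, hB₁⟩ := hK.exists_bound_of_continuousOn hfc.continuousOn
  obtain ⟨B₂, hB₂⟩ := hK.exists_bound_of_continuousOn hgc.continuousOn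
  have hfB : ∀ᵐ z ∂ν.prod θ, |f z| ≤ max B₁ B₂ := by
    filter_upwards [haeS, haeI] with z h1 h2
    exact (hB₁ z ⟨h1, h2⟩).trans (le_max_left _ _)
  have hgB : ∀ᵐ z ∂ν.prod θ, |g z| ≤ max B₁ B₂ := by
    filter_upwards [haeS, haeI] with z h1 h2
    exact (hB₂ z ⟨h1, h2⟩).trans (le_max_right _ _)
  have hfg : ∀ᵐ z ∂ν.prod θ, |f z - g z - (-(d * x))| * 2 ^ n ≤ 1 := by
    filter_upwards [hfst ((ae_mem_msupp ν).mono hνδ), hsnd ((ae_mem_msupp θ).mono hθδ), haeI]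
      with z h1 h2 h3
    have h4 := abs_polyEval_sub_le hδ.le hδ1 hp h1 hx h3 h2
    have h5 : f z - g z - (-(d * x)) =
        polyEval k z.1 z.2 - polyEval k z.1 x - d * (z.2 - x) := by
      simp only [f, g]; ring
    rw [h5]
    calc |polyEval k z.1 z.2 - polyEval k z.1 x - d * (z.2 - x)| * 2 ^ n
        ≤ C * δ ^ 2 * 2 ^ n := mul_le_mul_of_nonneg_right h4 (by positivity)
      _ = C * δ * (2 ^ n * δ) := by ring
      _ ≤ C * δ * 2 ^ m :=
        mul_le_mul_of_nonneg_left (two_pow_floor_mul_le m hδ hδ1) (by positivity)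
      _ ≤ (C + 1) * 2 ^ m * δ := by
        have : 0 ≤ 2 ^ m * δ := by positivity
        linarith
      _ ≤ 1 := hδ2
  have hgf : ∀ᵐ z ∂ν.prod θ, |g z - f z - d * x| * 2 ^ n ≤ 1 := by
    filter_upwards [hfg] with z h
    rwa [← abs_neg, show -(g z - f z - d * x) = f z - g z - (-(d * x)) by ring]
  have hle := ent1_map_le_add_two (ν.prod θ) hfc.measurable hgc.measurable n _ _ hfB hgB hfg
  have hge := ent1_map_le_add_two (ν.prod θ) hgc.measurable hfc.measurable n _ _ hgB hfB hgf
  rw [hconv, pact, ← mul_sub, abs_mul, abs_of_pos (by positivity : 0 < 1 / (m : ℝ)),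
    one_div, inv_mul_lt_iff₀ hmpos]
  exact (abs_sub_le_iff.2 ⟨by linarith, by linarith⟩).trans_lt hmε
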